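/- Let n ≥ 2, K ≥ 1 and ε > 0 with 1/K = ε/(n+ε). Define f: Bⁿ(0,1) → ℝⁿ by f(x) = |x|^{1/K} log^{1/(2nK)}(e/|x|) · x/|x| + (2, 0, …, 0) and σ by σⁿ(x) = (1/(2n)) |x|^{−n(K−1)/K} log^{−(2nK−n)/(2nK)}(e/|x|). Then f ∈ W^{1,n}(Bⁿ(0,1), ℝⁿ), σ ∈ L^{n+ε}(Bⁿ(0,1)), f satisfies the heterogeneous distortion inequality |Df|ⁿ ≤ K J_f + σⁿ|f|ⁿ a.e. on Bⁿ(0,1), and f is not locally (1/K)-Hölder continuous on Bⁿ(0,1), since |f(x) − f(0)|/|x|^{1/K} = log^{1/(2nK)}(e/|x|) → ∞ as x → 0. -/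

import Mathlib

open MeasureTheory Metric Set Filter
open scoped ENNReal Topology

noncomputable section

/-- Euclidean `n`-space. -/
abbrev Eu (n : ℕ) : Type := EuclideanSpace ℝ (Fin n)

/-- `Df` is the weak (distributional) derivative of `f` on the open set `Ω`,
expressed by integration by parts against smooth compactly supported test functions. -/
def IsWeakDerivOn {n : ℕ} {F : Type*} [NormedAddCommGroup F] [NormedSpace ℝ F]
    (Ω : Set (Eu n)) (f : Eu n → F) (Df : Eu n → Eu n →L[ℝ] F) : Prop :=
  ∀ φ : Eu n → ℝ, ContDiff ℝ (⊤ : ℕ∞) φ → HasCompactSupport φ → tsupport φ ⊆ Ω →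
    ∀ v : Eu n, ∫ x in Ω, φ x • Df x v = - ∫ x in Ω, fderiv ℝ φ x v • f x

/-- `f`, with weak derivative `Df`, belongs to the local Sobolev class `W^{1,p}_loc(Ω, F)`:
`Df` is a weak derivative of `f` on `Ω` and `‖f‖^p, ‖Df‖^p` are integrable on every
compact subset of `Ω`. -/
def MemW1Loc {n : ℕ} {F : Type*} [NormedAddCommGroup F] [NormedSpace ℝ F]
    (p : ℝ) (Ω : Set (Eu n)) (f : Eu n → F) (Df : Eu n → Eu n →L[ℝ] F) : Prop :=
  IsWeakDerivOn Ω f Df ∧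
  ∀ Kc : Set (Eu n), Kc ⊆ Ω → IsCompact Kc →
    IntegrableOn (fun x => ‖f x‖ ^ p) Kc volume ∧
    IntegrableOn (fun x => ‖Df x‖ ^ p) Kc volume

/-- The heterogeneous distortion inequality `|Df|^n ≤ K J_f + σ^n |f|^n` a.e. on `Ω`,
where `J_f = det Df`. -/
def HDistortion {n : ℕ} (Ω : Set (Eu n)) (f : Eu n → Eu n)
    (Df : Eu n → Eu n →L[ℝ] Eu n) (K : ℝ) (σ : Eu n → ℝ) : Prop :=
  ∀ᵐ x ∂volume, x ∈ Ω →
    ‖Df x‖ ^ (n : ℝ) ≤ K * (Df x).det + σ x ^ (n : ℝ) * ‖f x‖ ^ (n : ℝ)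


/-- `f` is locally `γ`-Hölder continuous on `Ω`. -/
def LocallyHolderOn {n : ℕ} {F : Type*} [NormedAddCommGroup F]
    (γ : ℝ) (Ω : Set (Eu n)) (f : Eu n → F) : Prop :=
  ∀ x ∈ Ω, ∃ U : Set (Eu n), IsOpen U ∧ x ∈ U ∧
    ∃ C : ℝ, ∀ y ∈ U ∩ Ω, ∀ z ∈ U ∩ Ω, ‖f y - f z‖ ≤ C * ‖y - z‖ ^ γ


theorem aux_integral_fderiv_zero {m : ℕ} {F : Type*} [NormedAddCommGroup F] [NormedSpace ℝ F]
    [CompleteSpace F]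
    (g : Eu (m + 1) → F) (hc : Continuous g) (hs : tsupport g ⊆ ball 0 1)
    (hd : ∀ x, x ≠ 0 → DifferentiableAt ℝ g x) (v : Eu (m + 1))
    (hi : Integrable (fun x => fderiv ℝ g x v)) :
    ∫ x, fderiv ℝ g x v = 0 := by
  classical
  let e : (Fin (m + 1) → ℝ) ≃L[ℝ] Eu (m + 1) :=
    (EuclideanSpace.equiv (Fin (m + 1)) ℝ).symm
  have hmp : MeasurePreserving (e : (Fin (m + 1) → ℝ) → Eu (m + 1)) volume volume :=
    PiLp.volume_preserving_toLp (Fin (m + 1))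
  have hme : MeasurableEmbedding (e : (Fin (m + 1) → ℝ) → Eu (m + 1)) :=
    e.toHomeomorph.measurableEmbedding
  rw [← hmp.integral_comp hme]
  have hcoord : ∀ (x : Fin (m + 1) → ℝ) (i), |x i| ≤ ‖e x‖ := fun x i =>
    PiLp.norm_apply_le (e x) i
  have hz : ∀ x : Fin (m + 1) → ℝ, ∀ i, 1 ≤ |x i| → g (e x) = 0 := by
    intro x i hx
    by_contra h
    have := hs (subset_tsupport g h)
    rw [mem_ball_zero_iff] at this
    linarith [hcoord x i]
  have hz' : ∀ x : Fin (m + 1) → ℝ, ∀ i, 1 ≤ |x i| → fderiv ℝ g (e x) = 0 := by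
    intro x i hx
    by_contra h
    have := hs (support_fderiv_subset ℝ (f := g) h)
    rw [mem_ball_zero_iff] at this
    linarith [hcoord x i]
  have hi' : Integrable (fun x => fderiv ℝ g (e x) v) :=
    (hmp.integrable_comp_emb hme).2 hi
  have hsum : ∀ x : Fin (m + 1) → ℝ,
      ∑ i, ((v i) • ((fderiv ℝ g (e x)).comp (e : (Fin (m + 1) → ℝ) →L[ℝ] Eu (m + 1))))
        (Pi.single i 1) = fderiv ℝ g (e x) v := by
    intro x
    have hv : v = ∑ i, v i • e (Pi.single i 1) := by
      apply e.symm.injective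
      rw [map_sum]
      ext j
      simp [Finset.sum_apply, Pi.single_apply, e]
    conv_rhs => rw [hv]
    simp [map_sum]
  have hdiv := integral_divergence_of_hasFDerivAt_off_countable'
    (fun _ : Fin (m + 1) => (-1 : ℝ)) (fun _ => 1) (fun _ => by norm_num)
    (fun i x => v i • g (e x))
    (fun i x => (v i) • ((fderiv ℝ g (e x)).comp (e : (Fin (m + 1) → ℝ) →L[ℝ] Eu (m + 1))))
    {0} (countable_singleton 0)
    (fun i => ((hc.comp e.continuous).const_smul (v i)).continuousOn)
    (by
      rintro x ⟨-, hx⟩ i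
      have hx0 : e x ≠ 0 := by simpa using hx
      exact ((hd _ hx0).hasFDerivAt.comp x e.hasFDerivAt).const_smul (v i))
    (by
      simp_rw [hsum]
      exact hi'.integrableOn)
  simp_rw [hsum] at hdiv
  rw [← setIntegral_eq_integral_of_forall_compl_eq_zero
    (s := Icc (fun _ : Fin (m + 1) => (-1 : ℝ)) (fun _ => 1)), hdiv]
  · apply Finset.sum_eq_zero
    intro i _
    have h1 : ∀ y : Fin m → ℝ, g (e (Fin.insertNth i (1 : ℝ) y)) = 0 := fun y =>
      hz _ i (by simp)
    have h2 : ∀ y : Fin m → ℝ, g (e (Fin.insertNth i (-1 : ℝ) y)) = 0 := fun y =>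
      hz _ i (by simp)
    simp [h1, h2]
  · intro x hx
    have : ∃ i, 1 ≤ |x i| := by
      by_contra! h
      exact hx ⟨fun i => (abs_lt.1 (h i)).1.le, fun i => (abs_lt.1 (h i)).2.le⟩
    obtain ⟨i, hi⟩ := this
    simp [hz' x i hi]

theorem aux_weak {m : ℕ} {F : Type*} [NormedAddCommGroup F] [NormedSpace ℝ F]
    [CompleteSpace F]
    (f : Eu (m + 1) → F) (hc : Continuous f)
    (hd : ∀ x ∈ ball (0 : Eu (m + 1)) 1, x ≠ 0 → DifferentiableAt ℝ f x)
    (hi : IntegrableOn (fun x => fderiv ℝ f x) (ball 0 1)) :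
    IsWeakDerivOn (ball (0 : Eu (m + 1)) 1) f (fderiv ℝ f) := by
  intro φ hφ hcs hts v
  have hφd : Differentiable ℝ φ := hφ.differentiable (by simp)
  have hφ' : Continuous (fderiv ℝ φ) := hφ.continuous_fderiv (by simp)
  have hA : IntegrableOn (fun x => φ x • fderiv ℝ f x v) (ball 0 1) := by
    obtain ⟨C, hC⟩ := hcs.exists_bound_of_continuous hφ.continuous
    have h1 : IntegrableOn (fun x => fderiv ℝ f x v) (ball 0 1) :=
      ((ContinuousLinearMap.apply ℝ F v).integrable_comp hi)
    exact h1.bdd_smul C hφ.continuous.aestronglyMeasurable (ae_of_all _ hC)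
  have hcont2 : Continuous (fun x => fderiv ℝ φ x v • f x) :=
    (hφ'.clm_apply continuous_const).smul hc
  have hz2 : ∀ x, x ∉ ball (0 : Eu (m + 1)) 1 → fderiv ℝ φ x = 0 := by
    intro x hx
    by_contra h
    exact hx (hts (support_fderiv_subset ℝ h))
  have hz1 : ∀ x, x ∉ ball (0 : Eu (m + 1)) 1 → φ x = 0 := by
    intro x hx
    by_contra h
    exact hx (hts (subset_tsupport _ h))
  have hcs2 : HasCompactSupport (fun x => fderiv ℝ φ x v • f x) := by
    refine (hcs.fderiv ℝ).mono fun x hx h => hx ?_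
    simp [h]
  have hB : Integrable (fun x => fderiv ℝ φ x v • f x) := hcont2.integrable_of_hasCompactSupport hcs2
  have hA' : Integrable (fun x => φ x • fderiv ℝ f x v) :=
    (integrableOn_iff_integrable_of_support_subset (fun x hx => by
      by_contra h
      exact hx (by simp [hz1 x h]))).1 hA
  rw [setIntegral_eq_integral_of_forall_compl_eq_zero (fun x hx => by simp [hz1 x hx]),
    setIntegral_eq_integral_of_forall_compl_eq_zero (fun x hx => by simp [hz2 x hx]),
    eq_neg_iff_add_eq_zero, ← integral_add hA' hB]
  have htg : tsupport (fun x => φ x • f x) ⊆ tsupport φ :=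
    tsupport_smul_subset_left φ f
  have hfd : ∀ x, x ≠ 0 → HasFDerivAt (fun x => φ x • f x)
      (φ x • fderiv ℝ f x + (fderiv ℝ φ x).smulRight (f x)) x ∨ x ∉ tsupport φ := by
    intro x hx
    by_cases h : x ∈ tsupport φ
    · exact Or.inl ((hφd x).hasFDerivAt.smul (hd x (hts h) hx).hasFDerivAt)
    · exact Or.inr h
  have hfz : ∀ x, x ∉ tsupport φ → HasFDerivAt (fun x => φ x • f x) (0 : Eu (m + 1) →L[ℝ] F) x := by
    intro x hx
    have : (fun x => φ x • f x) =ᶠ[𝓝 x] fun _ => 0 := by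
      have := notMem_tsupport_iff_eventuallyEq.1 hx
      filter_upwards [this] with y hy
      simp [hy]
    exact (hasFDerivAt_const (0 : F) x).congr_of_eventuallyEq this
  have heq : (fun x => φ x • fderiv ℝ f x v + fderiv ℝ φ x v • f x) =ᵐ[volume]
      fun x => fderiv ℝ (fun x => φ x • f x) x v := by
    have : ∀ᵐ x : Eu (m + 1), x ≠ 0 := by
      simp [ae_iff, measure_singleton]
    filter_upwards [this] with x hx
    rcases hfd x hx with h | h
    · rw [h.fderiv]; simp
    · rw [(hfz x h).fderiv]
      have h1 : φ x = 0 := by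
        by_contra h'
        exact h (subset_tsupport _ h')
      have h2 : fderiv ℝ φ x = 0 := by
        by_contra h'
        exact h (support_fderiv_subset ℝ h')
      simp [h1, h2]
  rw [integral_congr_ae heq]
  refine aux_integral_fderiv_zero _ (hφ.continuous.smul hc) (htg.trans hts) ?_ v
    ((hA'.add hB).congr heq)
  intro x hx
  rcases hfd x hx with h | h
  · exact h.differentiableAt
  · exact (hfz x h).differentiableAt

theorem aux_fderiv {n : ℕ} (w : ℝ → ℝ) (w' : ℝ) (c x : Eu n) (hx : x ≠ 0)
    (hw : HasDerivAt w w' ‖x‖) :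
    HasFDerivAt (fun y => w ‖y‖ • y + c)
      (w ‖x‖ • ContinuousLinearMap.id ℝ (Eu n) + (w' / ‖x‖) • (innerSL ℝ x).smulRight x) x := by
  have hr : 0 < ‖x‖ := norm_pos_iff.2 hx
  have h1 : HasFDerivAt (fun y : Eu n => ‖y‖) (‖x‖⁻¹ • innerSL ℝ x) x := by
    have h := (hasStrictFDerivAt_norm_sq x).hasFDerivAt.sqrt (by positivity)
    have h2 : (fun y : Eu n => √(‖y‖ ^ 2)) = fun y => ‖y‖ := by
      ext y; exact Real.sqrt_sq (norm_nonneg y)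
    rw [h2] at h
    refine h.congr_fderiv ?_
    rw [Real.sqrt_sq hr.le]
    ext y
    simp
    field_simp
  have h2 := ((hw.comp_hasFDerivAt x h1).smul (hasFDerivAt_id x)).add_const c
  refine h2.congr_fderiv ?_
  ext y i
  simp
  ring

theorem aux_norm {n : ℕ} (α β : ℝ) (x : Eu n) (hα : 0 ≤ α) (hβ : β ≤ 0)
    (h : 0 ≤ α + β * ‖x‖ ^ 2) :
    ‖α • ContinuousLinearMap.id ℝ (Eu n) + β • (innerSL ℝ x).smulRight x‖ ≤ α := by
  refine ContinuousLinearMap.opNorm_le_bound _ hα fun v => ?_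
  apply le_of_sq_le_sq _ (by positivity)
  simp only [add_apply, smul_apply,
    ContinuousLinearMap.id_apply, ContinuousLinearMap.smulRight_apply, innerSL_apply_apply]
  rw [norm_add_sq_real]
  simp only [norm_smul, inner_smul_left, inner_smul_right, real_inner_comm x v]
  simp only [mul_pow, Real.norm_eq_abs, sq_abs]
  simp
  nlinarith [mul_nonneg (neg_nonneg.2 hβ) (mul_nonneg (add_nonneg hα h) (sq_nonneg (inner ℝ x v)))]

theorem aux_det {n : ℕ} (α β : ℝ) (x : Eu n) (hα : α ≠ 0) (hn : n ≠ 0) :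
    (α • ContinuousLinearMap.id ℝ (Eu n) + β • (innerSL ℝ x).smulRight x).det
      = α ^ (n - 1) * (α + β * ‖x‖ ^ 2) := by
  have : ((α • ContinuousLinearMap.id ℝ (Eu n) + β • (innerSL ℝ x).smulRight x :
      Eu n →L[ℝ] Eu n) : Eu n →ₗ[ℝ] Eu n) =
      α • LinearMap.transvection ((innerSL ℝ x : Eu n →L[ℝ] ℝ) : Eu n →ₗ[ℝ] ℝ) ((β / α) • x) := by
    ext v i
    simp [LinearMap.transvection]
    field_simp
  rw [ContinuousLinearMap.det, this, LinearMap.det_smul, LinearMap.transvection.det]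
  obtain ⟨k, rfl⟩ := Nat.exists_eq_succ_of_ne_zero hn
  simp [pow_succ]
  field_simp

theorem aux_L_eq {r : ℝ} (hr : 0 < r) : Real.log (Real.exp 1 / r) = 1 - Real.log r := by
  rw [Real.log_div (Real.exp_pos 1).ne' hr.ne', Real.log_exp]

theorem aux_L_ge {r : ℝ} (hr : 0 < r) (h1 : r < 1) : 1 ≤ Real.log (Real.exp 1 / r) := by
  rw [aux_L_eq hr]
  linarith [Real.log_neg hr h1]

theorem aux_L_le {r : ℝ} (hr : 0 < r) : Real.log (Real.exp 1 / r) ≤ r⁻¹ := by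
  rw [aux_L_eq hr]
  have := Real.log_le_sub_one_of_pos (inv_pos.2 hr)
  rw [Real.log_inv] at this
  linarith

theorem aux_L_deriv {r : ℝ} (hr : 0 < r) :
    HasDerivAt (fun r => Real.log (Real.exp 1 / r)) (-r⁻¹) r := by
  have h : HasDerivAt (fun r => 1 - Real.log r) (-r⁻¹) r := by
    simpa using (Real.hasDerivAt_log hr.ne').const_sub 1
  refine h.congr_of_eventuallyEq ?_
  filter_upwards [eventually_gt_nhds hr] with y hy using aux_L_eq hy

theorem aux_L_top : Tendsto (fun r => Real.log (Real.exp 1 / r)) (𝓝[>] 0) atTop := by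
  have h : Tendsto (fun r => 1 - Real.log r) (𝓝[>] 0) atTop := by
    have := tendsto_neg_atBot_atTop.comp Real.tendsto_log_nhdsGT_zero
    simpa [sub_eq_add_neg] using tendsto_atTop_add_const_left _ (1 : ℝ) this
  refine h.congr' ?_
  filter_upwards [self_mem_nhdsWithin] with y hy using (aux_L_eq hy).symm

theorem aux_w_deriv {r : ℝ} (p a : ℝ) (hr : 0 < r) (h1 : r < 1) :
    HasDerivAt (fun r => r ^ p * Real.log (Real.exp 1 / r) ^ a * r⁻¹)
      ((p - 1 - a / Real.log (Real.exp 1 / r)) *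
        (r ^ p * Real.log (Real.exp 1 / r) ^ a * r⁻¹) / r) r := by
  have hL : 0 < Real.log (Real.exp 1 / r) := lt_of_lt_of_le one_pos (aux_L_ge hr h1)
  have := (((hasDerivAt_id r).rpow_const (p := p) (Or.inl hr.ne')).mul
    ((aux_L_deriv hr).rpow_const (p := a) (Or.inl hL.ne'))).mul (hasDerivAt_inv hr.ne')
  refine this.congr_deriv ?_
  simp only [id, Pi.mul_apply]
  rw [Real.rpow_sub_one hr.ne', Real.rpow_sub_one hL.ne']
  field_simp
  ring

/-- `ρ(r) ≤ r^(p-a)` -/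
theorem aux_rho_le {r : ℝ} (p a : ℝ) (ha : 0 ≤ a) (hr : 0 < r) (h1 : r < 1) :
    r ^ p * Real.log (Real.exp 1 / r) ^ a ≤ r ^ (p - a) := by
  have hL : 0 < Real.log (Real.exp 1 / r) := lt_of_lt_of_le one_pos (aux_L_ge hr h1)
  rw [sub_eq_add_neg, Real.rpow_add hr, Real.rpow_neg hr.le, ← Real.inv_rpow hr.le]
  gcongr
  exact aux_L_le hr

theorem aux_norm_rpow_int {n : ℕ} (hn : 1 ≤ n) (s : ℝ) (hs : -(n : ℝ) < s) :
    IntegrableOn (fun x : Eu n => ‖x‖ ^ s) (ball 0 1) := by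
  have : Nontrivial (Eu n) := by
    have : Nonempty (Fin n) := ⟨⟨0, hn⟩⟩
    infer_instance
  rw [integrableOn_fun_norm_addHaar (μ := volume) (f := fun r : ℝ => r ^ s)]
  have h : IntegrableOn (fun r : ℝ => r ^ ((n : ℝ) - 1 + s)) (Ioo 0 1) :=
    (intervalIntegral.integrableOn_Ioo_rpow_iff one_pos).2 (by linarith)
  refine h.congr_fun (fun r hr => ?_) measurableSet_Ioo
  simp only [finrank_euclideanSpace, Fintype.card_fin, smul_eq_mul]
  rw [Real.rpow_add hr.1, ← Real.rpow_natCast, Nat.cast_sub hn, Nat.cast_one]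

theorem aux_log_int {n : ℕ} (hn : 1 ≤ n) (q : ℝ) (hq : 1 < q) :
    IntegrableOn (fun x : Eu n => ‖x‖ ^ (-(n : ℝ)) * Real.log (Real.exp 1 / ‖x‖) ^ (-q))
      (ball 0 1) := by
  have : Nontrivial (Eu n) := by
    have : Nonempty (Fin n) := ⟨⟨0, hn⟩⟩
    infer_instance
  rw [integrableOn_fun_norm_addHaar (μ := volume)
    (f := fun r : ℝ => r ^ (-(n : ℝ)) * Real.log (Real.exp 1 / r) ^ (-q))]
  have h : IntegrableOn (fun r : ℝ => (-r⁻¹) * (1 - q) * Real.log (Real.exp 1 / r) ^ (1 - q - 1))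
      (Ioc 0 1) := by
    refine intervalIntegral.integrableOn_deriv_of_nonneg
      (g := fun r => Real.log (Real.exp 1 / r) ^ (1 - q)) ?_ ?_ ?_
    · intro r hr
      rcases hr.1.eq_or_lt with h0 | h0
      · subst h0
        apply ContinuousWithinAt.mono _ (t := insert 0 (Ioi 0)) (fun y hy => by
          rcases hy.1.eq_or_lt with h | h
          · exact Or.inl h.symm
          · exact Or.inr h)
        rw [continuousWithinAt_insert_self]
        have hq' : 1 - q ≠ 0 := by linarith
        have : Tendsto (fun r => Real.log (Real.exp 1 / r) ^ (1 - q)) (𝓝[>] 0) (𝓝 0) := by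
          have := (tendsto_rpow_neg_atTop (y := q - 1) (by linarith)).comp aux_L_top
          simpa [Function.comp_def] using this
        simpa [ContinuousWithinAt, Real.zero_rpow hq'] using this
      · have hL : 0 < Real.log (Real.exp 1 / r) := by
          rw [aux_L_eq h0]
          have := Real.log_nonpos h0.le hr.2
          linarith
        exact ((aux_L_deriv h0).rpow_const (p := 1 - q)
          (Or.inl hL.ne')).continuousAt.continuousWithinAt
    · intro r hr
      have hL := aux_L_ge hr.1 hr.2
      exact (aux_L_deriv hr.1).rpow_const (Or.inl (by linarith))
    · intro r hr
      have hL := aux_L_ge hr.1 hr.2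
      have : 0 ≤ Real.log (Real.exp 1 / r) ^ (1 - q - 1) := Real.rpow_nonneg (by linarith) _
      have h2 : 0 < r⁻¹ := inv_pos.2 hr.1
      have : 0 ≤ r⁻¹ * (q - 1) * Real.log (Real.exp 1 / r) ^ (1 - q - 1) :=
        mul_nonneg (mul_nonneg h2.le (by linarith)) this
      nlinarith
  have h' : IntegrableOn (fun r : ℝ => (q - 1)⁻¹ * ((-r⁻¹) * (1 - q) *
      Real.log (Real.exp 1 / r) ^ (1 - q - 1))) (Ioo 0 1) :=
    (h.mono_set Ioo_subset_Ioc_self).const_mul _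
  refine h'.congr_fun (fun r hr => ?_) measurableSet_Ioo
  have hr0 : r ≠ 0 := hr.1.ne'
  have hq0 : q - 1 ≠ 0 := by linarith
  simp only [finrank_euclideanSpace, Fintype.card_fin, smul_eq_mul]
  rw [Real.rpow_neg hr.1.le, Real.rpow_natCast, show 1 - q - 1 = -q by ring]
  have key : r ^ (n - 1) * (r ^ n)⁻¹ = r⁻¹ := by
    obtain ⟨k, rfl⟩ := Nat.exists_eq_add_of_le hn
    rw [add_comm 1 k, Nat.add_sub_cancel, pow_succ]
    field_simp
  have key2 : (q - 1)⁻¹ * (1 - q) = -1 := by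
    field_simp
    ring
  rw [← mul_assoc (r ^ (n - 1)), key]
  linear_combination (-r⁻¹ * Real.log (Real.exp 1 / r) ^ (-q)) * key2

theorem aux_rpow_nonneg (x a : ℝ) (ha : 0 ≤ a) (ha' : a ≤ 1 / 4) : 0 ≤ x ^ a := by
  rcases le_or_gt 0 x with h | h
  · exact Real.rpow_nonneg h a
  · rw [Real.rpow_def_of_neg h]
    refine mul_nonneg (Real.exp_pos _).le (Real.cos_nonneg_of_mem_Icc ⟨?_, ?_⟩) <;>
    nlinarith [Real.pi_pos]

/-- **Example (sharpness in the special case `γ_K = γ_ε`).**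
Let `K ≥ 1` and `ε > 0` with `1/K = ε/(n+ε)`.  The map
`f(x) = |x|^{1/K} log^{1/(2nK)}(e/|x|) · x/|x| + (2, 0, …, 0)` on `Bⁿ(0,1)`, together
with `σ` defined by `σⁿ(x) = (1/(2n)) |x|^{-n(K-1)/K} log^{-(2nK-n)/(2nK)}(e/|x|)`,
lies in `W^{1,n}(Bⁿ(0,1), ℝⁿ)` with `σ ∈ L^{n+ε}(Bⁿ(0,1))`, satisfies the heterogeneous
distortion inequality `|Df|ⁿ ≤ K J_f + σⁿ|f|ⁿ` a.e., and is not locally `1/K`-Hölder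
continuous, since `|f(x) - f(0)| / |x|^{1/K} = log^{1/(2nK)}(e/|x|) → ∞` as `x → 0`. -/
theorem sharpness_example_equal_exponents
    (n : ℕ) (hn : 2 ≤ n) (K ε : ℝ) (hK : 1 ≤ K) (hε : 0 < ε)
    (hKε : 1 / K = ε / ((n : ℝ) + ε))
    (f : Eu n → Eu n)
    (hf : f = fun x =>
      (‖x‖ ^ (1 / K) * Real.log (Real.exp 1 / ‖x‖) ^ (1 / (2 * (n : ℝ) * K))) •
          (‖x‖⁻¹ • x) +
        (2 : ℝ) • EuclideanSpace.single (⟨0, by omega⟩ : Fin n) (1 : ℝ))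
    (σ : Eu n → ℝ)
    (hσ : σ = fun x =>
      ((1 / (2 * (n : ℝ))) * ‖x‖ ^ (-((n : ℝ) * (K - 1)) / K) *
          Real.log (Real.exp 1 / ‖x‖) ^
            (-(2 * (n : ℝ) * K - (n : ℝ)) / (2 * (n : ℝ) * K))) ^ (1 / (n : ℝ))) :
    ∃ Df : Eu n → Eu n →L[ℝ] Eu n,
      IsWeakDerivOn (ball (0 : Eu n) 1) f Df ∧
      IntegrableOn (fun x => ‖f x‖ ^ (n : ℝ)) (ball (0 : Eu n) 1) volume ∧
      IntegrableOn (fun x => ‖Df x‖ ^ (n : ℝ)) (ball (0 : Eu n) 1) volume ∧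
      IntegrableOn (fun x => σ x ^ ((n : ℝ) + ε)) (ball (0 : Eu n) 1) volume ∧
      HDistortion (ball (0 : Eu n) 1) f Df K σ ∧
      -- the quantitative reason for failure of `1/K`-Hölder continuity at the origin:
      (∀ x : Eu n, x ≠ 0 →
        ‖f x - f 0‖ / ‖x‖ ^ (1 / K) = Real.log (Real.exp 1 / ‖x‖) ^ (1 / (2 * (n : ℝ) * K))) ∧
      ¬ LocallyHolderOn (1 / K) (ball (0 : Eu n) 1) f := by
  have hn0 : (0 : ℝ) < n := by positivity
  have hn2 : (2 : ℝ) ≤ n := by exact_mod_cast hn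
  have hK0 : 0 < K := by linarith
  set p : ℝ := 1 / K with hp
  set a : ℝ := 1 / (2 * (n : ℝ) * K) with ha
  have hp0 : 0 < p := by positivity
  have ha0 : 0 < a := by positivity
  have hpa : a * (2 * n) = p := by rw [hp, ha]; field_simp
  have hp1 : p < 1 := by
    rw [hKε, div_lt_one (by positivity)]; linarith
  have hap : a < p := by nlinarith
  have ha4 : a ≤ 1 / 4 := by nlinarith
  have hKp : K * p = 1 := by rw [hp]; field_simp
  set c : Eu n := (2 : ℝ) • EuclideanSpace.single (⟨0, by omega⟩ : Fin n) (1 : ℝ) with hc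
  have hcn : ‖c‖ = 2 := by simp [hc, norm_smul]
  set w : ℝ → ℝ := fun r => r ^ p * Real.log (Real.exp 1 / r) ^ a * r⁻¹ with hw
  have hf' : f = fun x => w ‖x‖ • x + c := by
    rw [hf]; ext1 x; simp only [hw, smul_smul]
  have hf0 : f 0 = c := by simp [hf']
  have hdiff : ∀ x : Eu n, x ≠ 0 →
      ‖f x - f 0‖ = ‖x‖ ^ p * Real.log (Real.exp 1 / ‖x‖) ^ a := by
    intro x hx
    have hr : 0 < ‖x‖ := norm_pos_iff.2 hx
    rw [hf0, hf']
    simp only [add_sub_cancel_right, norm_smul, hw, norm_mul, norm_inv, norm_norm]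
    rw [Real.norm_of_nonneg (Real.rpow_nonneg hr.le _),
      Real.norm_of_nonneg (aux_rpow_nonneg _ a ha0.le ha4)]
    field_simp
  have hquot : ∀ x : Eu n, x ≠ 0 →
        ‖f x - f 0‖ / ‖x‖ ^ p = Real.log (Real.exp 1 / ‖x‖) ^ a := by
    intro x hx
    have hr : 0 < ‖x‖ ^ p := Real.rpow_pos_of_pos (norm_pos_iff.2 hx) _
    rw [hdiff x hx]
    field_simp
  -- estimate of the displacement
  have hsmall : ∀ x : Eu n, ‖x‖ < 1 → ‖f x - f 0‖ ≤ ‖x‖ ^ (p - a) := by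
    intro x hx
    by_cases h0 : x = 0
    · subst h0; simp; positivity
    · rw [hdiff x h0]
      exact aux_rho_le p a ha0.le (norm_pos_iff.2 h0) hx
  have hcont : Continuous f := by
    rw [continuous_iff_continuousAt]
    intro x
    by_cases h0 : x = 0
    · subst h0
      rw [ContinuousAt, tendsto_iff_norm_sub_tendsto_zero]
      have ht : Tendsto (fun x : Eu n => ‖x‖ ^ (p - a)) (𝓝 0) (𝓝 0) := by
        have : Continuous (fun x : Eu n => ‖x‖ ^ (p - a)) :=
          continuous_norm.rpow_const (fun _ => Or.inr (by linarith))
        simpa [Real.zero_rpow (show p - a ≠ 0 by linarith)] using this.tendsto 0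
      refine squeeze_zero' (Eventually.of_forall fun _ => norm_nonneg _) ?_ ht
      filter_upwards [ball_mem_nhds (0 : Eu n) one_pos] with y hy
      exact hsmall y (by simpa using hy)
    · have hr : ‖x‖ ≠ 0 := norm_ne_zero_iff.2 h0
      rw [hf']
      have h1 : ContinuousAt (fun x : Eu n => Real.log (Real.exp 1 / ‖x‖)) x :=
        (continuousAt_const.div continuous_norm.continuousAt hr).log
          (div_ne_zero (Real.exp_pos 1).ne' hr)
      exact (((continuous_norm.continuousAt.rpow_const (Or.inl hr)).mul
        (h1.rpow_const (Or.inr ha0.le))).mul (continuous_norm.continuousAt.inv₀ hr)).smul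
        continuousAt_id |>.add continuousAt_const
  have hfd : ∀ x ∈ ball (0 : Eu n) 1, x ≠ 0 → HasFDerivAt f
      (w ‖x‖ • ContinuousLinearMap.id ℝ (Eu n) +
        ((p - 1 - a / Real.log (Real.exp 1 / ‖x‖)) * w ‖x‖ / ‖x‖ / ‖x‖) •
          (innerSL ℝ x).smulRight x) x := by
    intro x hx h0
    rw [hf']
    exact aux_fderiv w _ c x h0 (aux_w_deriv p a (norm_pos_iff.2 h0) (by simpa using hx))
  have hwpos : ∀ r : ℝ, 0 < r → r < 1 → 0 < w r := by
    intro r h0 h1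
    have hL := aux_L_ge h0 h1
    have : 0 < Real.log (Real.exp 1 / r) ^ a := Real.rpow_pos_of_pos (by linarith) _
    have h2 : 0 < r ^ p := Real.rpow_pos_of_pos h0 _
    exact mul_pos (mul_pos h2 this) (inv_pos.2 h0)
  have hwle : ∀ r : ℝ, 0 < r → r < 1 → w r ≤ r ^ (p - a - 1) := by
    intro r h0 h1
    rw [Real.rpow_sub_one h0.ne', div_eq_mul_inv]
    exact mul_le_mul_of_nonneg_right (aux_rho_le p a ha0.le h0 h1) (inv_pos.2 h0).le
  have haL : ∀ r : ℝ, 0 < r → r < 1 → 0 < a / Real.log (Real.exp 1 / r) ∧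
      a / Real.log (Real.exp 1 / r) ≤ a := by
    intro r h0 h1
    have hL := aux_L_ge h0 h1
    exact ⟨div_pos ha0 (by linarith), div_le_self ha0.le hL⟩
  have hnorm : ∀ x ∈ ball (0 : Eu n) 1, x ≠ 0 → ‖fderiv ℝ f x‖ ≤ w ‖x‖ := by
    intro x hx h0
    have hr : 0 < ‖x‖ := norm_pos_iff.2 h0
    have hr1 : ‖x‖ < 1 := by simpa using hx
    have hwp := hwpos _ hr hr1
    obtain ⟨h1, h2⟩ := haL _ hr hr1
    rw [(hfd x hx h0).fderiv]
    refine aux_norm _ _ x hwp.le ?_ ?_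
    · refine div_nonpos_of_nonpos_of_nonneg (div_nonpos_of_nonpos_of_nonneg
        (mul_nonpos_of_nonpos_of_nonneg (by linarith) hwp.le) hr.le) hr.le
    · have : w ‖x‖ + (p - 1 - a / Real.log (Real.exp 1 / ‖x‖)) * w ‖x‖ / ‖x‖ / ‖x‖ * ‖x‖ ^ 2
          = (p - a / Real.log (Real.exp 1 / ‖x‖)) * w ‖x‖ := by
        field_simp
        ring
      rw [this]
      exact mul_nonneg (by linarith) hwp.le
  have hdet : ∀ x ∈ ball (0 : Eu n) 1, x ≠ 0 → (fderiv ℝ f x).det =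
      w ‖x‖ ^ n * (p - a / Real.log (Real.exp 1 / ‖x‖)) := by
    intro x hx h0
    have hr : 0 < ‖x‖ := norm_pos_iff.2 h0
    have hr1 : ‖x‖ < 1 := by simpa using hx
    have hwp := hwpos _ hr hr1
    rw [(hfd x hx h0).fderiv, aux_det _ _ x hwp.ne' (by omega)]
    obtain ⟨k, rfl⟩ := Nat.exists_eq_succ_of_ne_zero (show n ≠ 0 by omega)
    simp only [Nat.succ_eq_add_one, Nat.add_sub_cancel, pow_succ]
    field_simp
    ring
  have hmeas : Measurable (fderiv ℝ f) := measurable_fderiv ℝ f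
  have hae0 : ∀ᵐ x : Eu n, x ≠ 0 := by
    have : Nonempty (Fin n) := ⟨⟨0, by omega⟩⟩
    simp [ae_iff, measure_singleton]
  have hDfn : IntegrableOn (fun x => ‖fderiv ℝ f x‖ ^ (n : ℝ)) (ball (0 : Eu n) 1) volume := by
    refine Integrable.mono' (aux_norm_rpow_int (n := n) (by omega) ((p - a - 1) * n)
      (by nlinarith)) (hmeas.norm.pow_const _).aestronglyMeasurable ?_
    rw [ae_restrict_iff' measurableSet_ball]
    filter_upwards [hae0] with x h0 hx
    have hr : 0 < ‖x‖ := norm_pos_iff.2 h0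
    have hr1 : ‖x‖ < 1 := by simpa using hx
    rw [Real.norm_of_nonneg (by positivity), Real.rpow_mul hr.le]
    gcongr
    exact (hnorm x hx h0).trans (hwle _ hr hr1)
  have hDf1 : IntegrableOn (fun x => fderiv ℝ f x) (ball (0 : Eu n) 1) volume := by
    refine Integrable.mono' (aux_norm_rpow_int (n := n) (by omega) (p - a - 1)
      (by nlinarith)) hmeas.aestronglyMeasurable ?_
    rw [ae_restrict_iff' measurableSet_ball]
    filter_upwards [hae0] with x h0 hx
    have hr : 0 < ‖x‖ := norm_pos_iff.2 h0
    have hr1 : ‖x‖ < 1 := by simpa using hx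
    exact (hnorm x hx h0).trans (hwle _ hr hr1)
  refine ⟨fderiv ℝ f, ?_, ?_, hDfn, ?_, ?_, hquot, ?_⟩
  · obtain ⟨m, rfl⟩ := Nat.exists_eq_succ_of_ne_zero (show n ≠ 0 by omega)
    exact aux_weak f hcont (fun x hx h0 => (hfd x hx h0).differentiableAt) hDf1
  · have : Continuous (fun x => ‖f x‖ ^ (n : ℝ)) :=
      hcont.norm.rpow_const (fun _ => Or.inr hn0.le)
    exact (this.continuousOn.integrableOn_compact (isCompact_closedBall 0 1)).mono_set
      ball_subset_closedBall
  · -- integrability of `σ`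
    have hKe : K * ε = n + ε := by
      rw [hp] at hKε
      field_simp at hKε
      linarith
    have hK1 : 1 < K := by nlinarith
    set q : ℝ := (2 * (n : ℝ) * K - n) / (2 * n * K) * (((n : ℝ) + ε) / n) with hq
    have hq1 : 1 < q := by
      have : q = (2 * K - 1) * ε / (2 * n) := by
        rw [hq, ← hKe]; field_simp
      rw [this, lt_div_iff₀ (by positivity)]
      nlinarith
    refine ((aux_log_int (n := n) (by omega) q hq1).const_mul
      ((1 / (2 * (n : ℝ))) ^ (((n : ℝ) + ε) / n))).congr ?_
    rw [EventuallyEq, ae_restrict_iff' measurableSet_ball]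
    filter_upwards [hae0] with x h0 hx
    have hr : 0 < ‖x‖ := norm_pos_iff.2 h0
    have hr1 : ‖x‖ < 1 := by simpa using hx
    have hL : 0 < Real.log (Real.exp 1 / ‖x‖) := lt_of_lt_of_le one_pos (aux_L_ge hr hr1)
    rw [hσ]
    simp only
    rw [← Real.rpow_mul (by positivity), Real.mul_rpow (by positivity) (by positivity),
      Real.mul_rpow (by positivity) (by positivity), ← Real.rpow_mul hr.le, ← Real.rpow_mul hL.le,
      ← mul_assoc]
    have e0 : 1 / (n : ℝ) * (n + ε) = (n + ε) / n := by ring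
    have e1 : -((n : ℝ) * (K - 1)) / K * ((n + ε) / n) = -n := by
      rw [← hKe]
      field_simp
      linarith
    have e2 : -(2 * (n : ℝ) * K - n) / (2 * n * K) * ((n + ε) / n) = -q := by
      rw [hq]; ring
    rw [e0, e1, e2]
  · -- distortion inequality
    filter_upwards [hae0] with x h0 hx
    have hr : 0 < ‖x‖ := norm_pos_iff.2 h0
    have hr1 : ‖x‖ < 1 := by simpa using hx
    have hL : 0 < Real.log (Real.exp 1 / ‖x‖) := lt_of_lt_of_le one_pos (aux_L_ge hr hr1)
    have hwp := hwpos _ hr hr1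
    rw [hdet x hx h0]
    have hwn : w ‖x‖ ^ n = ‖x‖ ^ (n * (p - 1)) * Real.log (Real.exp 1 / ‖x‖) ^ (n * a) := by
      simp only [hw]
      rw [mul_right_comm, ← div_eq_mul_inv, ← Real.rpow_sub_one hr.ne', mul_pow,
        ← Real.rpow_natCast, ← Real.rpow_natCast, ← Real.rpow_mul hr.le, ← Real.rpow_mul hL.le,
        mul_comm (p - 1), mul_comm a]
    have hσn : σ x ^ (n : ℝ) = w ‖x‖ ^ n * (K * (a / Real.log (Real.exp 1 / ‖x‖))) := by
      rw [hσ]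
      simp only
      rw [← Real.rpow_mul (by positivity), one_div_mul_cancel hn0.ne', Real.rpow_one, hwn]
      have e1 : -((n : ℝ) * (K - 1)) / K = n * (p - 1) := by
        rw [hp]; field_simp; ring
      have e2 : -(2 * (n : ℝ) * K - n) / (2 * n * K) = n * a - 1 := by
        rw [ha]; field_simp; ring
      rw [e1, e2, Real.rpow_sub_one hL.ne']
      have e3 : K * a = 1 / (2 * n) := by rw [ha]; field_simp
      rw [mul_div_assoc' K, e3]
      ring
    have hfx : 1 ≤ ‖f x‖ := by
      have h1 := hsmall x hr1
      have h2 : ‖x‖ ^ (p - a) ≤ 1 := Real.rpow_le_one hr.le hr1.le (by linarith)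
      have h3 : ‖f 0‖ ≤ ‖f x‖ + ‖f x - f 0‖ := by
        have := norm_sub_le (f x) (f x - f 0)
        simpa using this
      rw [hf0, hcn] at h3
      rw [hf0] at h1
      linarith
    have hfx' : 1 ≤ ‖f x‖ ^ (n : ℝ) := Real.one_le_rpow hfx hn0.le
    have hD : ‖fderiv ℝ f x‖ ^ (n : ℝ) ≤ w ‖x‖ ^ n := by
      rw [Real.rpow_natCast]
      gcongr
      exact hnorm x hx h0
    have hσ0 : 0 ≤ σ x ^ (n : ℝ) := by
      rw [hσn]; positivity
    calc ‖fderiv ℝ f x‖ ^ (n : ℝ) ≤ w ‖x‖ ^ n := hD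
      _ = K * (w ‖x‖ ^ n * (p - a / Real.log (Real.exp 1 / ‖x‖))) + σ x ^ (n : ℝ) := by
        rw [hσn]
        linear_combination (-w ‖x‖ ^ n) * hKp
      _ ≤ _ := by
        gcongr
        exact le_mul_of_one_le_right hσ0 hfx'
  · intro hH
    obtain ⟨U, hU, h0U, C, hC⟩ := hH 0 (by simp)
    have : Nonempty (Fin n) := ⟨⟨0, by omega⟩⟩
    have : Nontrivial (Eu n) := inferInstance
    have ht : Tendsto (fun x : Eu n => Real.log (Real.exp 1 / ‖x‖) ^ a) (𝓝[≠] 0) atTop :=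
      (tendsto_rpow_atTop ha0).comp (aux_L_top.comp (tendsto_norm_nhdsNE_zero))
    have hev : ∀ᶠ x in 𝓝[≠] (0 : Eu n), x ∈ U ∩ ball 0 1 :=
      mem_nhdsWithin_of_mem_nhds (inter_mem (hU.mem_nhds h0U) (ball_mem_nhds _ one_pos))
    obtain ⟨x, hx1, hx2, hx3⟩ := ((ht.eventually_gt_atTop C).and
      (hev.and self_mem_nhdsWithin)).exists
    have hx0 : x ≠ 0 := hx3
    have h := hC x hx2 0 ⟨h0U, by simp⟩
    rw [sub_zero, ← div_le_iff₀ (Real.rpow_pos_of_pos (norm_pos_iff.2 hx0) _), hquot x hx0] at h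
    linarith
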